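/- Let a, b ∈ ℂ and let W(a,b) be the Lie conformal algebra given by the free ℂ[∂]-module with basis {L, M} and λ-brackets [L_λ L] = (∂+2λ)L, [L_λ M] = (∂+aλ+b)M, [M_λ M] = 0 (extended by conformal sesquilinearity and skew-symmetry). A ℂ-bilinear λ-product ∘_λ on W(a,b) (extended by conformal sesquilinearity) makes (W(a,b), ∘_λ) an associative conformal algebra (not necessarily commutative) satisfying the transposed conformal Leibniz rule 2(x∘_λ[y_μ z]) = [(x∘_λ y)_{λ+μ} z] + [y_μ(x∘_λ z)] with respect to the bracket of W(a,b) if and only if: when a ≠ 2, L∘_λL = L∘_λM = M∘_λL = M∘_λM = 0; and when a = 2, ∘_λ has one of the following forms: (2.1) L∘_λL = s(λ)M and L∘_λM = M∘_λL = M∘_λM = 0 for some s(λ) ∈ ℂ[λ]; (2.2) L∘_λL = c₁L + c₂λM, L∘_λM = c₁M, M∘_λL = M∘_λM = 0 for some c₁ ∈ ℂ∖{0}, c₂ ∈ ℂ; (2.3) L∘_λL = c₁L + c₃M, L∘_λM = M∘_λL = c₁M, M∘_λM = 0 for some c₁ ∈ ℂ∖{0}, c₃ ∈ ℂ; (2.4)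 L∘_λL = (m−kλ)L + ((km/c₀)λ − (k²/c₀)λ²)M, L∘_λM = (m−kλ)M, M∘_λL = c₀L + kλM, M∘_λM = c₀M for some c₀ ∈ ℂ∖{0}, m, k ∈ ℂ. -/

import Mathlib

/-!
We model a `ℂ[∂]`-module as a complex vector space `L` together with an
endomorphism `D` (the action of `∂`).  A `λ`-product (or `λ`-bracket) is a
`ℂ`-bilinear map `L → L → L[λ]`, where the polynomial `x ∘_λ y = Σₙ λⁿ • cₙ`
is encoded by its finitely supported family of coefficients `ℕ →₀ L`.
Substitution of the variable `λ` by a complex scalar, or by an operator such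
as `-∂-λ`, is given by `ev`; since `ℂ` is infinite, an identity of
polynomials in (several) variables `λ, μ, γ` with coefficients in a complex
vector space holds formally if and only if it holds for all complex values
of the variables, which is how all identities are stated below.
-/

namespace ConfFormal

variable {L : Type*} [AddCommGroup L] [Module ℂ L]

/-- Evaluation of a polynomial `p = Σₙ λⁿ • pₙ` with coefficients in `L`
(encoded as the family of its coefficients) at an endomorphism `T` of `L`
(for instance at a scalar `λ`, or at an operator such as `-∂-λ`). -/
noncomputable def ev (T : Module.End ℂ L) (p : ℕ →₀ L) : L :=
  p.sum fun n x => (T ^ n) x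

/-- `app m T x y` is `x ∘_T y` : the `λ`-product `x ∘_λ y` recorded by the
`ℂ`-bilinear coefficient map `m`, with the variable `λ` substituted by the
endomorphism `T`. -/
noncomputable def app (m : L →ₗ[ℂ] L →ₗ[ℂ] (ℕ →₀ L)) (T : Module.End ℂ L) (x y : L) : L :=
  ev T (m x y)

/-- The scalar `c` viewed as an endomorphism of `L`. -/
noncomputable def sc (c : ℂ) : Module.End ℂ L := c • (1 : Module.End ℂ L)

/-- `(L, D, m)` is a conformal algebra: conformal sesquilinearity holds. -/
structure IsConfAlg (D : Module.End ℂ L) (m : L →ₗ[ℂ] L →ₗ[ℂ] (ℕ →₀ L)) : Prop where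
  sesq_left : ∀ (x y : L) (l : ℂ), app m (sc l) (D x) y = -l • app m (sc l) x y
  sesq_right : ∀ (x y : L) (l : ℂ),
    app m (sc l) x (D y) = D (app m (sc l) x y) + l • app m (sc l) x y

/-- `(L, D, m)` is a commutative associative conformal algebra. -/
structure IsCommAssocConfAlg (D : Module.End ℂ L) (m : L →ₗ[ℂ] L →ₗ[ℂ] (ℕ →₀ L))
    extends IsConfAlg D m : Prop where
  assoc : ∀ (x y z : L) (l u : ℂ),
    app m (sc l) x (app m (sc u) y z) = app m (sc (l + u)) (app m (sc l) x y) z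
  comm : ∀ (x y : L) (l : ℂ), app m (sc l) x y = app m (-(D + sc l)) y x

/-- `(L, D, br)` is a Lie conformal algebra. -/
structure IsLieConfAlg (D : Module.End ℂ L) (br : L →ₗ[ℂ] L →ₗ[ℂ] (ℕ →₀ L)) : Prop where
  sesq_left : ∀ (x y : L) (l : ℂ), app br (sc l) (D x) y = -l • app br (sc l) x y
  skew : ∀ (x y : L) (l : ℂ), app br (sc l) x y = -app br (-(sc l + D)) y x
  jacobi : ∀ (x y z : L) (l u : ℂ),
    app br (sc l) x (app br (sc u) y z) =
      app br (sc (l + u)) (app br (sc l) x y) z + app br (sc u) y (app br (sc l) x z)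

/-- `(L, D, m, br)` is a transposed Poisson conformal algebra. -/
structure IsTPCA (D : Module.End ℂ L) (m br : L →ₗ[ℂ] L →ₗ[ℂ] (ℕ →₀ L)) : Prop where
  commAssoc : IsCommAssocConfAlg D m
  lie : IsLieConfAlg D br
  tLeibniz : ∀ (x y z : L) (l u : ℂ),
    (2 : ℂ) • app m (sc l) x (app br (sc u) y z) =
      app br (sc (l + u)) (app m (sc l) x y) z + app br (sc u) y (app m (sc l) x z)


/-- `(L, D, m)` is a (not necessarily commutative) associative conformal
algebra. -/
structure IsAssocConfAlg (D : Module.End ℂ L) (m : L →ₗ[ℂ] L →ₗ[ℂ] (ℕ →₀ L))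
    extends IsConfAlg D m : Prop where
  assoc : ∀ (x y z : L) (l u : ℂ),
    app m (sc l) x (app m (sc u) y z) = app m (sc (l + u)) (app m (sc l) x y) z

section Helpers

open Polynomial

section Bilinear

variable {V : Type*} [AddCommGroup V] [Module ℂ V]

/-- For a fixed value of the variable, `app` is a bilinear map. -/
noncomputable def appLin (m : V →ₗ[ℂ] V →ₗ[ℂ] (ℕ →₀ V)) (T : Module.End ℂ V) :
    V →ₗ[ℂ] V →ₗ[ℂ] V :=
  m.compr₂ (Finsupp.lsum ℂ fun n => T ^ n)

lemma app_eq_appLin (m : V →ₗ[ℂ] V →ₗ[ℂ] (ℕ →₀ V)) (T : Module.End ℂ V) (x y : V) :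
    app m T x y = appLin m T x y := rfl

lemma sc_pow_apply (l : ℂ) (n : ℕ) (x : V) : (sc l ^ n : Module.End ℂ V) x = l ^ n • x := by
  simp [sc, _root_.smul_pow]

/-- A coordinate of `x ∘_λ y` is a polynomial function of `λ`. -/
lemma exists_polynomial_app (m : V →ₗ[ℂ] V →ₗ[ℂ] (ℕ →₀ V)) (x y : V) (φ : V →ₗ[ℂ] ℂ) :
    ∃ P : ℂ[X], ∀ l : ℂ, φ (app m (sc l) x y) = P.eval l := by
  refine ⟨(m x y).sum fun n v => C (φ v) * X ^ n, fun l => ?_⟩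
  simp only [app, ev, Finsupp.sum, map_sum, eval_finsetSum, eval_mul, eval_C, eval_pow, eval_X,
    sc_pow_apply, map_smul, smul_eq_mul]
  exact Finset.sum_congr rfl fun _ _ => mul_comm _ _

end Bilinear

section Polynomials

lemma eq_C_of_X_add_C_mul {u v w : ℂ} {q : ℂ[X]} (h : (X + C u) * q = C v * X + C w) :
    q = C v ∧ u * v = w := by
  have h1 : (X + C u) * (q - C v) = C (w - u * v) := by
    simp only [map_sub, map_mul]
    linear_combination h
  have h2 : q - C v = 0 := by
    by_contra hne
    have := congrArg natDegree h1
    rw [natDegree_mul (X_add_C_ne_zero u) hne, natDegree_X_add_C, natDegree_C] at this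
    omega
  refine ⟨sub_eq_zero.mp h2, ?_⟩
  rw [h2, mul_zero, eq_comm, C_eq_zero] at h1
  exact (sub_eq_zero.mp h1).symm

lemma eval_eq_zero_or_eval_eq {Q : ℂ[X]} {c : ℂ}
    (h : ∀ l, Q.eval l * (c - Q.eval l) = 0) : (∀ l, Q.eval l = 0) ∨ ∀ l, Q.eval l = c := by
  have h0 : Q * (C c - Q) = 0 := Polynomial.funext fun l => by simpa using h l
  rcases mul_eq_zero.mp h0 with h1 | h1
  · exact Or.inl fun l => by simp [h1]
  · refine Or.inr fun l => ?_
    rw [← sub_eq_zero.mp h1, eval_C]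

lemma exists_eval_eq_mul_of_additive {Q : ℂ[X]}
    (h : ∀ l u, Q.eval (l + u) = Q.eval l + Q.eval u) : ∃ k : ℂ, ∀ l, Q.eval l = k * l := by
  have hder : derivative Q = C ((derivative Q).eval 0) := by
    refine Polynomial.funext fun u => ?_
    have h1 : Q.comp (X + C u) = Q + C (Q.eval u) :=
      Polynomial.funext fun l => by simpa using h l u
    have h2 := congrArg (fun p => (derivative p).eval 0) h1
    simpa [derivative_comp] using h2
  set k := (derivative Q).eval 0
  have h3 : derivative (Q - C k * X) = 0 := by simp [hder]
  have h4 := eq_C_of_natDegree_eq_zero (derivative_eq_zero.mp h3)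
  have hQ0 : Q.eval 0 = 0 := by simpa using h 0 0
  refine ⟨k, fun l => ?_⟩
  have h5 := congrArg (eval l) h4
  have h6 : Q.coeff 0 = 0 := by rw [coeff_zero_eq_eval_zero, hQ0]
  simpa [h6, sub_eq_zero] using h5

end Polynomials

section Free

variable {D : Module.End ℂ (ℂ[X] × ℂ[X])}
  {m br : (ℂ[X] × ℂ[X]) →ₗ[ℂ] (ℂ[X] × ℂ[X]) →ₗ[ℂ] (ℕ →₀ (ℂ[X] × ℂ[X]))}

lemma C_smul_prod (c : ℂ) (f : ℂ[X] × ℂ[X]) : (C c : ℂ[X]) • f = c • f := by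
  ext1 <;> simp [smul_eq_C_mul]

lemma eq_X_smul (hD : ∀ f : ℂ[X] × ℂ[X], D f = (X * f.1, X * f.2)) (f : ℂ[X] × ℂ[X]) :
    D f = (X : ℂ[X]) • f := by
  rw [hD]
  ext1 <;> simp

lemma app_smul_left (hD : ∀ f : ℂ[X] × ℂ[X], D f = (X * f.1, X * f.2)) (hm : IsConfAlg D m)
    (l : ℂ) (p : ℂ[X]) (x y : ℂ[X] × ℂ[X]) :
    app m (sc l) (p • x) y = p.eval (-l) • app m (sc l) x y := by
  have hX := eq_X_smul hD
  induction p using Polynomial.induction_on generalizing x with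
  | C c => simp [C_smul_prod, app_eq_appLin]
  | add p q hp hq =>
    simp only [app_eq_appLin] at *
    simp [add_smul, hp, hq]
  | monomial n c h =>
    have : (C c * X ^ (n + 1) : ℂ[X]) • x = (C c * X ^ n) • D x := by
      rw [hX, smul_smul, pow_succ, mul_assoc]
    rw [this, h, hm.sesq_left, smul_smul]
    congr 1
    simp [pow_succ, mul_assoc]

lemma app_smul_right (hD : ∀ f : ℂ[X] × ℂ[X], D f = (X * f.1, X * f.2)) (hm : IsConfAlg D m)
    (l : ℂ) (p : ℂ[X]) (x y : ℂ[X] × ℂ[X]) :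
    app m (sc l) x (p • y) = p.comp (X + C l) • app m (sc l) x y := by
  have hX := eq_X_smul hD
  induction p using Polynomial.induction_on generalizing y with
  | C c => simp [C_smul_prod, app_eq_appLin]
  | add p q hp hq =>
    simp only [app_eq_appLin] at *
    simp [add_smul, hp, hq]
  | monomial n c h =>
    have : (C c * X ^ (n + 1) : ℂ[X]) • y = (C c * X ^ n) • D y := by
      rw [hX, smul_smul, pow_succ, mul_assoc]
    rw [this, h, hm.sesq_right, hX, ← C_smul_prod, ← add_smul, smul_smul]
    congr 1
    simp [pow_succ, mul_assoc]

lemma eq_smul_add_smul (f : ℂ[X] × ℂ[X]) :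
    f = f.1 • ((1 : ℂ[X]), (0 : ℂ[X])) + f.2 • ((0 : ℂ[X]), (1 : ℂ[X])) := by
  ext1 <;> simp

/-- A conformal product on a free module is determined by its values on the generators. -/
lemma app_eq_of_generators (hD : ∀ f : ℂ[X] × ℂ[X], D f = (X * f.1, X * f.2))
    (hm : IsConfAlg D m) (l : ℂ) (f g : ℂ[X] × ℂ[X]) :
    app m (sc l) f g
      = f.1.eval (-l) • (g.1.comp (X + C l) • app m (sc l) ((1 : ℂ[X]), (0 : ℂ[X])) (1, 0)
          + g.2.comp (X + C l) • app m (sc l) ((1 : ℂ[X]), (0 : ℂ[X])) (0, 1))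
        + f.2.eval (-l) • (g.1.comp (X + C l) • app m (sc l) ((0 : ℂ[X]), (1 : ℂ[X])) (1, 0)
          + g.2.comp (X + C l) • app m (sc l) ((0 : ℂ[X]), (1 : ℂ[X])) (0, 1)) := by
  have hl := app_smul_left hD hm l
  have hr := app_smul_right hD hm l
  conv_lhs => rw [eq_smul_add_smul f, eq_smul_add_smul g]
  simp only [app_eq_appLin] at *
  simp only [map_add, LinearMap.add_apply, hl, hr, smul_add]
  abel

/-- The products in which left multiplication by each generator sends `L` to a constant
combination of `L` and `M`, and `M` to the same multiple of `M`. -/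
structure HasScalarForm (m : (ℂ[X] × ℂ[X]) →ₗ[ℂ] (ℂ[X] × ℂ[X]) →ₗ[ℂ] (ℕ →₀ (ℂ[X] × ℂ[X])))
    (p₁ q₁ p₂ q₂ : ℂ → ℂ) : Prop where
  LL : ∀ l, app m (sc l) ((1 : ℂ[X]), (0 : ℂ[X])) (1, 0) = (C (p₁ l), C (q₁ l))
  LM : ∀ l, app m (sc l) ((1 : ℂ[X]), (0 : ℂ[X])) (0, 1) = (0, C (p₁ l))
  ML : ∀ l, app m (sc l) ((0 : ℂ[X]), (1 : ℂ[X])) (1, 0) = (C (p₂ l), C (q₂ l))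
  MM : ∀ l, app m (sc l) ((0 : ℂ[X]), (1 : ℂ[X])) (0, 1) = (0, C (p₂ l))

namespace HasScalarForm

variable {p₁ q₁ p₂ q₂ : ℂ → ℂ}

lemma app_eq (h : HasScalarForm m p₁ q₁ p₂ q₂)
    (hD : ∀ f : ℂ[X] × ℂ[X], D f = (X * f.1, X * f.2)) (hm : IsConfAlg D m)
    (l : ℂ) (f g : ℂ[X] × ℂ[X]) :
    app m (sc l) f g
      = (C (f.1.eval (-l) * p₁ l + f.2.eval (-l) * p₂ l) * g.1.comp (X + C l),
         C (f.1.eval (-l) * q₁ l + f.2.eval (-l) * q₂ l) * g.1.comp (X + C l)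
          + C (f.1.eval (-l) * p₁ l + f.2.eval (-l) * p₂ l) * g.2.comp (X + C l)) := by
  rw [app_eq_of_generators hD hm, h.LL, h.LM, h.ML, h.MM]
  ext1
  · simp [smul_eq_C_mul]
    ring
  · simp [smul_eq_C_mul]
    ring

lemma tLeibniz (h : HasScalarForm m p₁ q₁ p₂ q₂)
    (hD : ∀ f : ℂ[X] × ℂ[X], D f = (X * f.1, X * f.2)) (hm : IsConfAlg D m) {b : ℂ}
    (hbr : ∀ (f g : ℂ[X] × ℂ[X]) (l : ℂ),
      app br (sc l) f g
        = (f.1.eval (-l) • (g.1.comp (X + C l) * (X + C (2 * l))),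
           f.1.eval (-l) • (g.2.comp (X + C l) * (X + C (2 * l + b)))
             + f.2.eval (-l) • (g.1.comp (X + C l) * (C (2 - 1) * X + C (2 * l - b)))))
    (x y z : ℂ[X] × ℂ[X]) (l u : ℂ) :
    (2 : ℂ) • app m (sc l) x (app br (sc u) y z) =
      app br (sc (l + u)) (app m (sc l) x y) z + app br (sc u) y (app m (sc l) x z) := by
  simp only [h.app_eq hD hm, hbr]
  ext1
  · refine Polynomial.funext fun t => ?_
    have e2 : t + l + u = t + (l + u) := by ring
    have e3 : t + u + l = t + (l + u) := by ring
    simp [e2, e3]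
    ring
  · refine Polynomial.funext fun t => ?_
    have e2 : t + l + u = t + (l + u) := by ring
    have e3 : t + u + l = t + (l + u) := by ring
    simp [e2, e3]
    ring

/-- Associativity of a product in scalar form is a system of functional equations. -/
lemma assoc (h : HasScalarForm m p₁ q₁ p₂ q₂)
    (hD : ∀ f : ℂ[X] × ℂ[X], D f = (X * f.1, X * f.2)) (hm : IsConfAlg D m)
    (hLL : ∀ l u, p₁ l * p₁ u = p₁ l * p₁ (l + u) + q₁ l * p₂ (l + u))
    (hLM : ∀ l u, p₁ l * p₂ u = p₁ l * p₂ (l + u))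
    (hML : ∀ l u, p₂ l * p₁ u = p₂ l * p₁ (l + u) + q₂ l * p₂ (l + u))
    (hMM : ∀ l u, p₂ l * p₂ u = p₂ l * p₂ (l + u))
    (kLL : ∀ l u, p₁ u * q₁ l + q₁ u * p₁ l = p₁ l * q₁ (l + u) + q₁ l * q₂ (l + u))
    (kLM : ∀ l u, p₂ u * q₁ l + q₂ u * p₁ l = p₁ l * q₂ (l + u))
    (kML : ∀ l u, p₁ u * q₂ l + q₁ u * p₂ l = p₂ l * q₁ (l + u) + q₂ l * q₂ (l + u))
    (kMM : ∀ l u, p₂ u * q₂ l + q₂ u * p₂ l = p₂ l * q₂ (l + u)) :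
    IsAssocConfAlg D m := by
  refine ⟨hm, fun x y z l u => ?_⟩
  simp only [h.app_eq hD hm]
  ext1
  · refine Polynomial.funext fun t => ?_
    have e2 : t + l + u = t + (l + u) := by ring
    simp [e2]
    linear_combination (x.1.eval (-l) * y.1.eval (-u) * z.1.eval (t + (l + u))) * hLL l u
      + (x.1.eval (-l) * y.2.eval (-u) * z.1.eval (t + (l + u))) * hLM l u
      + (x.2.eval (-l) * y.1.eval (-u) * z.1.eval (t + (l + u))) * hML l u
      + (x.2.eval (-l) * y.2.eval (-u) * z.1.eval (t + (l + u))) * hMM l u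
  · refine Polynomial.funext fun t => ?_
    have e2 : t + l + u = t + (l + u) := by ring
    simp [e2]
    linear_combination (x.1.eval (-l) * y.1.eval (-u) * z.1.eval (t + (l + u))) * kLL l u
      + (x.1.eval (-l) * y.2.eval (-u) * z.1.eval (t + (l + u))) * kLM l u
      + (x.2.eval (-l) * y.1.eval (-u) * z.1.eval (t + (l + u))) * kML l u
      + (x.2.eval (-l) * y.2.eval (-u) * z.1.eval (t + (l + u))) * kMM l u
      + (x.1.eval (-l) * y.1.eval (-u) * z.2.eval (t + (l + u))) * hLL l u
      + (x.1.eval (-l) * y.2.eval (-u) * z.2.eval (t + (l + u))) * hLM l u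
      + (x.2.eval (-l) * y.1.eval (-u) * z.2.eval (t + (l + u))) * hML l u
      + (x.2.eval (-l) * y.2.eval (-u) * z.2.eval (t + (l + u))) * hMM l u

end HasScalarForm

/-- At a fixed value of the variable, a conformal `1/2`-derivation of `W(a,b)` is scalar up to a
constant multiple of `L ↦ M`, and this freedom exists only when `a = 2`. -/
lemma halfDerivation_form {a b : ℂ} (hD : ∀ f : ℂ[X] × ℂ[X], D f = (X * f.1, X * f.2))
    (hm : IsConfAlg D m)
    (hbr : ∀ (f g : ℂ[X] × ℂ[X]) (l : ℂ),
      app br (sc l) f g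
        = (f.1.eval (-l) • (g.1.comp (X + C l) * (X + C (2 * l))),
           f.1.eval (-l) • (g.2.comp (X + C l) * (X + C (a * l + b)))
             + f.2.eval (-l) • (g.1.comp (X + C l) * (C (a - 1) * X + C (a * l - b)))))
    (x : ℂ[X] × ℂ[X]) (l : ℂ)
    (hT : ∀ y z : ℂ[X] × ℂ[X], (2 : ℂ) • app m (sc l) x (app br (sc 0) y z) =
      app br (sc (l + 0)) (app m (sc l) x y) z + app br (sc 0) y (app m (sc l) x z)) :
    ∃ p q : ℂ, app m (sc l) x (1, 0) = (C p, C q) ∧ app m (sc l) x (0, 1) = (0, C p) ∧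
      (a - 2) * l * p = 0 ∧ (a - 2) * q = 0 := by
  have hr := app_smul_right hD hm l
  have hLL : app br (sc 0) ((1 : ℂ[X]), (0 : ℂ[X])) (1, 0)
      = (X : ℂ[X]) • ((1 : ℂ[X]), (0 : ℂ[X])) := by
    rw [hbr]; ext1 <;> simp
  have hLM : app br (sc 0) ((1 : ℂ[X]), (0 : ℂ[X])) (0, 1)
      = (X + C b : ℂ[X]) • ((0 : ℂ[X]), (1 : ℂ[X])) := by
    rw [hbr]; ext1 <;> simp
  have h1 := hT (1, 0) (1, 0)
  have h2 := hT (1, 0) (0, 1)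
  rw [hLL, hr, hbr, hbr] at h1
  rw [hLM, hr, hbr, hbr] at h2
  generalize app m (sc l) x (1, 0) = F at *
  generalize app m (sc l) x (0, 1) = G at *
  obtain ⟨p, q⟩ := F
  obtain ⟨r, s⟩ := G
  simp only [Prod.ext_iff, Prod.smul_fst, Prod.smul_snd, Prod.fst_add, Prod.snd_add,
    smul_eq_C_mul, smul_eq_mul] at h1 h2
  obtain ⟨h11, h12⟩ := h1
  obtain ⟨h21, h22⟩ := h2
  simp [C_ofNat] at h11 h12 h21 h22
  have hp : p = C (p.eval (-l)) := by
    refine (eq_C_of_X_add_C_mul (u := 2 * l) (w := 2 * l * p.eval (-l)) ?_).1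
    simp only [map_mul, C_ofNat]
    linear_combination h11
  generalize p.eval (-l) = c at *
  subst hp
  obtain ⟨hq, hq'⟩ := eq_C_of_X_add_C_mul (u := 2 * l - b) (v := q.eval (-l) * (a - 1))
    (w := q.eval (-l) * (a * l - b)) (q := q) (by
      simp only [map_mul, map_sub, C_ofNat, C_1]
      linear_combination h12)
  have hr0 : r = 0 := by
    refine (mul_eq_zero.mp ?_ : X + C (2 * l + 2 * b) = 0 ∨ r = 0).resolve_left
      (X_add_C_ne_zero _)
    simp only [map_mul, map_add, C_ofNat]
    linear_combination h21
  obtain ⟨hs, hs'⟩ := eq_C_of_X_add_C_mul (u := 2 * l + b) (v := c)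
    (w := c * (a * l + b)) (q := s) (by
      simp only [map_mul, map_add, C_ofNat]
      linear_combination h22)
  have hq1 : q.eval (-l) = q.eval (-l) * (a - 1) := by
    conv_lhs => rw [hq, eval_C]
  refine ⟨c, q.eval (-l), ?_, ?_, ?_, ?_⟩
  · rw [Prod.mk.injEq]
    exact ⟨rfl, by rw [← hq1] at hq; exact hq⟩
  · rw [hr0, hs]
  · linear_combination -hs'
  · linear_combination -hq1

/-- The values of left multiplication by `x` on the generators, as polynomials in `λ`. -/
lemma exists_polynomial_form {a : ℂ} (x : ℂ[X] × ℂ[X])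
    (h : ∀ l : ℂ, ∃ p q : ℂ, app m (sc l) x (1, 0) = (C p, C q) ∧
      app m (sc l) x (0, 1) = (0, C p) ∧ (a - 2) * l * p = 0 ∧ (a - 2) * q = 0) :
    ∃ P Q : ℂ[X], (∀ l, app m (sc l) x (1, 0) = (C (P.eval l), C (Q.eval l))) ∧
      (∀ l, app m (sc l) x (0, 1) = (0, C (P.eval l))) ∧
      (a ≠ 2 → P = 0 ∧ Q = 0) := by
  obtain ⟨P, hP⟩ := exists_polynomial_app m x (1, 0) (lcoeff ℂ 0 ∘ₗ LinearMap.fst ℂ ℂ[X] ℂ[X])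
  obtain ⟨Q, hQ⟩ := exists_polynomial_app m x (1, 0) (lcoeff ℂ 0 ∘ₗ LinearMap.snd ℂ ℂ[X] ℂ[X])
  choose p q h1 h2 h3 h4 using h
  have hp : ∀ l, p l = P.eval l := fun l => by simpa [h1] using hP l
  have hq : ∀ l, q l = Q.eval l := fun l => by simpa [h1] using hQ l
  simp only [hp, hq] at h1 h2 h3 h4
  refine ⟨P, Q, h1, h2, fun ha => ?_⟩
  have ha' := sub_ne_zero.mpr ha
  have hP0 : X * P = 0 := Polynomial.funext fun l => by
    simpa [ha'] using h3 l
  exact ⟨(mul_eq_zero.mp hP0).resolve_left X_ne_zero,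
    Polynomial.funext fun l => by simpa [ha'] using h4 l⟩

end Free

end Helpers

open Polynomial in
/-- Classification of the compatible noncommutative
transposed Poisson conformal algebra structures on the Lie conformal algebra
`W(a,b)`.  `W(a,b)` is modelled as the free `ℂ[∂]`-module
`ℂ[∂]L ⊕ ℂ[∂]M = ℂ[∂] × ℂ[∂]` with generators `L = (1,0)`, `M = (0,1)`, `∂`
acting as multiplication by `X` in each component, and bracket determined by
`[L_λ L] = (∂+2λ)L`, `[L_λ M] = (∂+aλ+b)M`, `[M_λ M] = 0` (so
`[M_λ L] = ((a-1)∂+aλ-b)M`), extended by conformal sesquilinearity: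
`[f(∂)_λ g(∂)] ↦ f(-λ) g(∂+λ) ·(bracket of generators)`.
A `ℂ`-bilinear `λ`-product `∘_λ` on `W(a,b)` makes it an associative
conformal algebra satisfying the transposed conformal Leibniz rule with
respect to this bracket if and only if it is conformal sesquilinear and its
values on the generators are: all zero when `a ≠ 2`, and of one of the four
listed forms (2.1)–(2.4) when `a = 2`. -/
theorem wab_tpca_structures (a b : ℂ)
    (D : Module.End ℂ (Polynomial ℂ × Polynomial ℂ))
    (hD : ∀ f : Polynomial ℂ × Polynomial ℂ, D f = (Polynomial.X * f.1, Polynomial.X * f.2))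
    (br : (Polynomial ℂ × Polynomial ℂ) →ₗ[ℂ] (Polynomial ℂ × Polynomial ℂ) →ₗ[ℂ]
      (ℕ →₀ (Polynomial ℂ × Polynomial ℂ)))
    (hbr : ∀ (f g : Polynomial ℂ × Polynomial ℂ) (l : ℂ),
      app br (sc l) f g
        = (f.1.eval (-l) • (g.1.comp (X + C l) * (X + C (2 * l))),
           f.1.eval (-l) • (g.2.comp (X + C l) * (X + C (a * l + b)))
             + f.2.eval (-l) • (g.1.comp (X + C l) * (C (a - 1) * X + C (a * l - b)))))
    (m : (Polynomial ℂ × Polynomial ℂ) →ₗ[ℂ] (Polynomial ℂ × Polynomial ℂ) →ₗ[ℂ]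
      (ℕ →₀ (Polynomial ℂ × Polynomial ℂ))) :
    (IsAssocConfAlg D m ∧
      ∀ (x y z : Polynomial ℂ × Polynomial ℂ) (l u : ℂ),
        (2 : ℂ) • app m (sc l) x (app br (sc u) y z) =
          app br (sc (l + u)) (app m (sc l) x y) z + app br (sc u) y (app m (sc l) x z)) ↔
    (IsConfAlg D m ∧
      ((a ≠ 2 →
        ∀ l : ℂ,
          app m (sc l) ((1 : Polynomial ℂ), (0 : Polynomial ℂ)) (1, 0) = 0 ∧
          app m (sc l) ((1 : Polynomial ℂ), (0 : Polynomial ℂ)) (0, 1) = 0 ∧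
          app m (sc l) ((0 : Polynomial ℂ), (1 : Polynomial ℂ)) (1, 0) = 0 ∧
          app m (sc l) ((0 : Polynomial ℂ), (1 : Polynomial ℂ)) (0, 1) = 0) ∧
      (a = 2 →
        -- (2.1)
        (∃ s : Polynomial ℂ, ∀ l : ℂ,
          app m (sc l) ((1 : Polynomial ℂ), (0 : Polynomial ℂ)) (1, 0) = (0, C (s.eval l)) ∧
          app m (sc l) ((1 : Polynomial ℂ), (0 : Polynomial ℂ)) (0, 1) = 0 ∧
          app m (sc l) ((0 : Polynomial ℂ), (1 : Polynomial ℂ)) (1, 0) = 0 ∧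
          app m (sc l) ((0 : Polynomial ℂ), (1 : Polynomial ℂ)) (0, 1) = 0) ∨
        -- (2.2)
        (∃ c₁ : ℂ, c₁ ≠ 0 ∧ ∃ c₂ : ℂ, ∀ l : ℂ,
          app m (sc l) ((1 : Polynomial ℂ), (0 : Polynomial ℂ)) (1, 0) = (C c₁, C (c₂ * l)) ∧
          app m (sc l) ((1 : Polynomial ℂ), (0 : Polynomial ℂ)) (0, 1) = (0, C c₁) ∧
          app m (sc l) ((0 : Polynomial ℂ), (1 : Polynomial ℂ)) (1, 0) = 0 ∧
          app m (sc l) ((0 : Polynomial ℂ), (1 : Polynomial ℂ)) (0, 1) = 0) ∨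
        -- (2.3)
        (∃ c₁ : ℂ, c₁ ≠ 0 ∧ ∃ c₃ : ℂ, ∀ l : ℂ,
          app m (sc l) ((1 : Polynomial ℂ), (0 : Polynomial ℂ)) (1, 0) = (C c₁, C c₃) ∧
          app m (sc l) ((1 : Polynomial ℂ), (0 : Polynomial ℂ)) (0, 1) = (0, C c₁) ∧
          app m (sc l) ((0 : Polynomial ℂ), (1 : Polynomial ℂ)) (1, 0) = (0, C c₁) ∧
          app m (sc l) ((0 : Polynomial ℂ), (1 : Polynomial ℂ)) (0, 1) = 0) ∨
        -- (2.4)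
        (∃ c₀ : ℂ, c₀ ≠ 0 ∧ ∃ m₀ k : ℂ, ∀ l : ℂ,
          app m (sc l) ((1 : Polynomial ℂ), (0 : Polynomial ℂ)) (1, 0)
            = (C (m₀ - k * l), C (k * m₀ / c₀ * l - k ^ 2 / c₀ * l ^ 2)) ∧
          app m (sc l) ((1 : Polynomial ℂ), (0 : Polynomial ℂ)) (0, 1) = (0, C (m₀ - k * l)) ∧
          app m (sc l) ((0 : Polynomial ℂ), (1 : Polynomial ℂ)) (1, 0) = (C c₀, C (k * l)) ∧
          app m (sc l) ((0 : Polynomial ℂ), (1 : Polynomial ℂ)) (0, 1) = (0, C c₀))))) := by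
  constructor
  · rintro ⟨hA, hT⟩
    have hm := hA.toIsConfAlg
    refine ⟨hm, ?_⟩
    obtain ⟨P₁, Q₁, hLL, hLM, h1⟩ := exists_polynomial_form (m := m) (a := a) (1, 0)
      fun l => halfDerivation_form hD hm hbr _ l fun y z => hT _ y z l 0
    obtain ⟨P₂, Q₂, hML, hMM, h2⟩ := exists_polynomial_form (m := m) (a := a) (0, 1)
      fun l => halfDerivation_form hD hm hbr _ l fun y z => hT _ y z l 0
    have hF : HasScalarForm m P₁.eval Q₁.eval P₂.eval Q₂.eval := ⟨hLL, hLM, hML, hMM⟩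
    refine ⟨fun ha l => ?_, fun _ => ?_⟩
    · obtain ⟨rfl, rfl⟩ := h1 ha
      obtain ⟨rfl, rfl⟩ := h2 ha
      simp [hLL, hLM, hML, hMM]
    · have key := fun x y l u => hA.assoc x y (1, 0) l u
      simp only [hF.app_eq hD hm, Prod.mk.injEq] at key
      have rLL : ∀ l u, P₁.eval l * P₁.eval u
          = P₁.eval l * P₁.eval (l + u) + Q₁.eval l * P₂.eval (l + u) := fun l u => by
        simpa [mul_comm] using congrArg (eval 0) (key (1, 0) (1, 0) l u).1
      have rML : ∀ l u, P₂.eval l * P₁.eval u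
          = P₂.eval l * P₁.eval (l + u) + Q₂.eval l * P₂.eval (l + u) := fun l u => by
        simpa [mul_comm] using congrArg (eval 0) (key (0, 1) (1, 0) l u).1
      have rMM : ∀ l u, P₂.eval l * P₂.eval u
          = P₂.eval l * P₂.eval (l + u) := fun l u => by
        simpa [mul_comm] using congrArg (eval 0) (key (0, 1) (0, 1) l u).1
      have kLL : ∀ l u, P₁.eval u * Q₁.eval l + P₁.eval l * Q₁.eval u
          = P₁.eval l * Q₁.eval (l + u) + Q₁.eval l * Q₂.eval (l + u) := fun l u => by
        simpa [mul_comm] using congrArg (eval 0) (key (1, 0) (1, 0) l u).2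
      have kLM : ∀ l u, P₂.eval u * Q₁.eval l + P₁.eval l * Q₂.eval u
          = P₁.eval l * Q₂.eval (l + u) := fun l u => by
        simpa [mul_comm] using congrArg (eval 0) (key (1, 0) (0, 1) l u).2
      have kML : ∀ l u, P₁.eval u * Q₂.eval l + P₂.eval l * Q₁.eval u
          = P₂.eval l * Q₁.eval (l + u) + Q₂.eval l * Q₂.eval (l + u) := fun l u => by
        simpa [mul_comm] using congrArg (eval 0) (key (0, 1) (1, 0) l u).2
      have kMM : ∀ l u, P₂.eval u * Q₂.eval l + P₂.eval l * Q₂.eval u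
          = P₂.eval l * Q₂.eval (l + u) := fun l u => by
        simpa [mul_comm] using congrArg (eval 0) (key (0, 1) (0, 1) l u).2
      have hP₂ : ∀ l, P₂.eval l = P₂.eval 0 := by
        rcases eval_eq_zero_or_eval_eq (Q := P₂) (c := P₂.eval 0) (fun l => by
          have := rMM l 0
          rw [add_zero] at this
          linear_combination this) with h | h
        · simp [h]
        · exact h
      generalize P₂.eval 0 = c₀ at hP₂
      simp only [hP₂] at *
      by_cases hc : c₀ = 0
      · subst hc
        have hP₁ : ∀ l, P₁.eval l = P₁.eval 0 := by
          rcases eval_eq_zero_or_eval_eq (Q := P₁) (c := P₁.eval 0) (fun l => by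
            have := rLL l 0
            rw [add_zero] at this
            linear_combination this) with h | h
          · simp [h]
          · exact h
        generalize P₁.eval 0 = c₁ at hP₁
        simp only [hP₁] at *
        have hQ₂ := eval_eq_zero_or_eval_eq (Q := Q₂) (c := c₁) (fun l => by
          have := kML l 0
          rw [add_zero] at this
          linear_combination this)
        by_cases hc₁ : c₁ = 0
        · subst hc₁
          have hQ₂' : ∀ l, Q₂.eval l = 0 := hQ₂.elim id id
          exact Or.inl ⟨Q₁, fun l => by simp [hLL, hLM, hML, hMM, hQ₂']⟩
        · rcases hQ₂ with hQ₂ | hQ₂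
          · obtain ⟨c₂, h⟩ := exists_eval_eq_mul_of_additive (Q := Q₁) fun l u =>
              mul_left_cancel₀ hc₁ (by linear_combination -kLL l u - Q₁.eval l * hQ₂ (l + u))
            exact Or.inr (Or.inl ⟨c₁, hc₁, c₂, fun l => by simp [hLL, hLM, hML, hMM, hQ₂, h]⟩)
          · have h : ∀ l, Q₁.eval l = Q₁.eval 0 := fun l =>
              mul_left_cancel₀ hc₁ (by
                have := kLL l 0
                rw [add_zero] at this
                linear_combination -this - Q₁.eval l * hQ₂ l)
            exact Or.inr (Or.inr (Or.inl ⟨c₁, hc₁, Q₁.eval 0, fun l => by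
              simp [hLL, hLM, hML, hMM, hQ₂, ← h l]⟩))
      · obtain ⟨k, hk⟩ := exists_eval_eq_mul_of_additive (Q := Q₂) fun l u =>
          mul_left_cancel₀ hc (by linear_combination -kMM l u)
        have hP₁ : ∀ l, P₁.eval l = P₁.eval 0 - k * l := fun l =>
          mul_left_cancel₀ hc (by
            have := rML l 0
            rw [add_zero] at this
            linear_combination -this - c₀ * hk l)
        have hQ₁ : ∀ l, Q₁.eval l = k * P₁.eval 0 / c₀ * l - k ^ 2 / c₀ * l ^ 2 := fun l => by
          have := kLM l 0
          rw [add_zero, hk, hk, hP₁] at this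
          field_simp
          linear_combination this
        refine Or.inr (Or.inr (Or.inr ⟨c₀, hc, P₁.eval 0, k, fun l => ?_⟩))
        rw [hLL, hLM, hML, hMM, hQ₁, hP₁ l, hk]
        exact ⟨rfl, rfl, rfl, rfl⟩
  · rintro ⟨hm, h, h'⟩
    by_cases ha : a = 2
    · subst ha
      obtain ⟨p₁, q₁, p₂, q₂, hF, hA⟩ : ∃ p₁ q₁ p₂ q₂, HasScalarForm m p₁ q₁ p₂ q₂ ∧
          IsAssocConfAlg D m := by
        rcases h' rfl with ⟨s, hs⟩ | ⟨c₁, -, c₂, hs⟩ | ⟨c₁, -, c₃, hs⟩ | ⟨c₀, hc, m₀, k, hs⟩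
        · have hF : HasScalarForm m (fun _ => 0) s.eval (fun _ => 0) (fun _ => 0) := by
            constructor <;> intro l <;> simp [hs l, Prod.ext_iff]
          exact ⟨_, _, _, _, hF, by apply hF.assoc hD hm <;> intros <;> ring⟩
        · have hF : HasScalarForm m (fun _ => c₁) (fun l => c₂ * l) (fun _ => 0)
              (fun _ => 0) := by
            constructor <;> intro l <;> simp [hs l, Prod.ext_iff]
          exact ⟨_, _, _, _, hF, by apply hF.assoc hD hm <;> intros <;> ring⟩
        · have hF : HasScalarForm m (fun _ => c₁) (fun _ => c₃) (fun _ => 0)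
              (fun _ => c₁) := by
            constructor <;> intro l <;> simp [hs l, Prod.ext_iff]
          exact ⟨_, _, _, _, hF, by apply hF.assoc hD hm <;> intros <;> ring⟩
        · have hF : HasScalarForm m (fun l => m₀ - k * l)
              (fun l => k * m₀ / c₀ * l - k ^ 2 / c₀ * l ^ 2) (fun _ => c₀)
              (fun l => k * l) := by
            constructor <;> intro l <;> simp only [hs l]
          exact ⟨_, _, _, _, hF, by apply hF.assoc hD hm <;> intros <;> field_simp <;> ring⟩
      exact ⟨hA, hF.tLeibniz hD hm hbr⟩
    · have hz : ∀ x y l, app m (sc l) x y = 0 := fun x y l => by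
        obtain ⟨h1, h2, h3, h4⟩ := h ha l
        rw [app_eq_of_generators hD hm, h1, h2, h3, h4]
        simp
      refine ⟨⟨hm, fun x y z l u => by simp only [hz]⟩, fun x y z l u => ?_⟩
      simp only [hz]
      simp [app_eq_appLin]

end ConfFormal
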